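/- arXiv:2503.04326 — 2 statements merged into one kernel-verified Lean document; each statement's English description precedes it below -/
import Mathlib

section
/- Let E be a separable Banach space, let μ be a centered Gaussian probability measure on E, and let X and X̄ be independent E-valued random variables, each with law μ. Let ϱ ∈ [−1, 1] and set X' := ϱ·X + √(1 − ϱ²)·X̄. Then the pair (X, X') has the same joint law as the pair (X', X); in particular the joint law of (X, X') on E × E is symmetric under the swap map. -/
open MeasureTheory ProbabilityTheory

/-- A probability measure on a normed space is a centered Gaussian measure if all of its
one-dimensional pushforwards under continuous linear functionals are centered Gaussian
distributions on `ℝ`. -/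
def IsCenteredGaussianMeasure {E : Type*} [NormedAddCommGroup E] [NormedSpace ℝ E]
    [MeasurableSpace E] (μ : Measure E) : Prop :=
  ∀ L : E →L[ℝ] ℝ, ∃ v : NNReal, μ.map L = gaussianReal 0 v

theorem pcn_map_reflection_eq_self
    {E : Type*} [NormedAddCommGroup E] [NormedSpace ℝ E] [CompleteSpace E]
    [SecondCountableTopology E] [MeasurableSpace E] [BorelSpace E]
    (μ : Measure E) [IsGaussian μ] (hμ : ∀ L : StrongDual ℝ E, μ[L] = 0)
    (a b : ℝ) (hab : a ^ 2 + b ^ 2 = 1) (T : E × E →L[ℝ] E × E)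
    (hT : ∀ p, T p = (a • p.1 + b • p.2, b • p.1 - a • p.2)) :
    (μ.prod μ).map T = μ.prod μ := by
  refine Measure.ext_of_charFunDual ?_
  ext L
  simp_rw [charFunDual_map, charFunDual_prod,
    IsGaussian.charFunDual_eq_of_forall_strongDual_eq_zero hμ, ← Complex.exp_add]
  rw [← add_div, ← add_div, ← neg_add, ← neg_add]
  congr 3
  norm_cast
  have h1 : (L.comp T).comp (.inl ℝ E E)
      = a • L.comp (.inl ℝ E E) + b • L.comp (.inr ℝ E E) := by
    ext x
    simp only [ContinuousLinearMap.comp_apply, ContinuousLinearMap.inl_apply, hT]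
    rw [← L.comp_inl_add_comp_inr]
    simp
  have h2 : (L.comp T).comp (.inr ℝ E E)
      = b • L.comp (.inl ℝ E E) - a • L.comp (.inr ℝ E E) := by
    ext x
    simp only [ContinuousLinearMap.comp_apply, ContinuousLinearMap.inr_apply, hT]
    rw [← L.comp_inl_add_comp_inr]
    simp only [smul_zero, zero_add, zero_sub, map_neg, map_smul]
    simp only [add_apply, smul_apply, sub_eq_add_neg, ContinuousLinearMap.comp_apply]
    rfl
  rw [h1, h2]
  simp only [FunLike.coe_sub, FunLike.coe_smul, FunLike.coe_add]
  rw [variance_sub, variance_smul, variance_add, variance_smul, variance_smul, covariance_smul_left,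
    covariance_smul_right, variance_smul, covariance_smul_left, covariance_smul_right]
  · grind
  all_goals exact (IsGaussian.memLp_dual _ _ _ (by simp)).const_smul _

/-- Exchangeability of the autoregressive (preconditioned Crank–Nicolson) proposal: if `X`, `X̄`
are independent random variables with values in a separable Banach space `E`, each with law a
centered Gaussian measure `μ`, `ϱ ∈ [−1, 1]` and `X' = ϱ·X + √(1 − ϱ²)·X̄`, then `(X, X')` and
`(X', X)` have the same joint law, i.e. the joint law is symmetric under the swap map. -/
theorem pcn_proposal_exchangeable
    {E : Type*} [NormedAddCommGroup E] [NormedSpace ℝ E] [CompleteSpace E]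
    [TopologicalSpace.SeparableSpace E] [MeasurableSpace E] [BorelSpace E]
    {Ω : Type*} [MeasurableSpace Ω] (Pr : Measure Ω) [IsProbabilityMeasure Pr]
    (μ : Measure E) [IsProbabilityMeasure μ] (hμ : IsCenteredGaussianMeasure μ)
    (X Xbar : Ω → E) (hX : Measurable X) (hXbar : Measurable Xbar)
    (hlawX : Pr.map X = μ) (hlawXbar : Pr.map Xbar = μ)
    (hindep : IndepFun X Xbar Pr)
    (ϱ : ℝ) (hϱ : ϱ ∈ Set.Icc (-1 : ℝ) 1)
    (X' : Ω → E) (hX' : X' = fun ω => ϱ • X ω + Real.sqrt (1 - ϱ ^ 2) • Xbar ω) :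
    Pr.map (fun ω => (X ω, X' ω)) = Pr.map (fun ω => (X' ω, X ω)) := by
  have : SecondCountableTopology E := UniformSpace.secondCountable_of_separable E
  have hG : IsGaussian μ := isGaussian_of_map_eq_gaussianReal fun L => ⟨0, hμ L⟩
  have h0 : ∀ L : StrongDual ℝ E, μ[L] = 0 := by
    intro L
    obtain ⟨v, hv⟩ := hμ L
    have h := integral_map (μ := μ) (φ := L) (f := fun x : ℝ => x)
      (by fun_prop) (by fun_prop)
    rw [hv, integral_id_gaussianReal] at h
    exact h.symm
  have hs : Real.sqrt (1 - ϱ ^ 2) ^ 2 = 1 - ϱ ^ 2 :=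
    Real.sq_sqrt (by nlinarith [hϱ.1, hϱ.2])
  generalize Real.sqrt (1 - ϱ ^ 2) = s at hs hX'
  have hab : ϱ ^ 2 + s ^ 2 = 1 := by linarith
  have hjoint : Pr.map (fun ω => (X ω, Xbar ω)) = μ.prod μ := by
    rw [(indepFun_iff_map_prod_eq_prod_map_map hX.aemeasurable hXbar.aemeasurable).1 hindep,
      hlawX, hlawXbar]
  let T : E × E →L[ℝ] E × E :=
    (ϱ • ContinuousLinearMap.fst ℝ E E + s • ContinuousLinearMap.snd ℝ E E).prod
      (s • ContinuousLinearMap.fst ℝ E E - ϱ • ContinuousLinearMap.snd ℝ E E)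
  have hT : ∀ p, T p = (ϱ • p.1 + s • p.2, s • p.1 - ϱ • p.2) := fun p => rfl
  have hrefl := pcn_map_reflection_eq_self μ h0 ϱ s hab T hT
  have hXX : Measurable (fun ω => (X ω, Xbar ω)) := hX.prodMk hXbar
  let g : E × E → E × E := fun p => (p.1, ϱ • p.1 + s • p.2)
  have hg : Measurable g := by fun_prop
  have e1 : (fun ω => (X ω, X' ω)) = g ∘ (fun ω => (X ω, Xbar ω)) := by
    subst hX'; rfl
  have e2 : (fun ω => (X' ω, X ω)) = (g ∘ T) ∘ (fun ω => (X ω, Xbar ω)) := by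
    subst hX'
    funext ω
    simp only [Function.comp, hT, g, Prod.mk.injEq, true_and]
    have : X ω = (ϱ ^ 2 + s ^ 2) • X ω := by rw [hab, one_smul]
    conv_lhs => rw [this]
    module
  rw [e1, e2, ← Measure.map_map hg hXX,
    ← Measure.map_map (hg.comp T.continuous.measurable) hXX, hjoint,
    ← Measure.map_map hg T.continuous.measurable, hrefl]
end

section
/- Let d, d' ≥ 1, let P be a positive definite real d × d matrix, ν ∈ ℝ^d, C > 0, let B be a real d × d matrix, m ∈ ℝ^d, let σ be a real d × d' matrix, and set a := σσᵀ. Define v : ℝ^d → ℝ by v(x) = C · (2π)^{−d/2} · (det P)^{−1/2} · exp(−(1/2)⟨x − ν, P⁻¹(x − ν)⟩), and define the generator 𝔏v(x) := ⟨Bx + m, ∇v(x)⟩ + (1/2) Σ_{i,j=1}^d a_{ij} ∂²v/∂x_i∂x_j (x). Then ∫_{ℝ^d} 𝔏v(x) dx = −Tr(B) · C, the integral being with respect to Lebesgue measure on ℝ^d. -/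
open MeasureTheory Matrix

theorem gA_std {d : ℕ} (ℓ₁ ℓ₂ : (Fin d → ℝ) →L[ℝ] ℝ) (c₁ c₂ : ℝ) :
    Integrable (fun z : Fin d → ℝ => (ℓ₁ z + c₁) * (ℓ₂ z + c₂) *
      Real.exp (-(1/2) * ∑ k, z k ^ 2)) := by
  have h4 : Integrable (fun z : Fin d → ℝ => ∏ k, Real.exp (-(1/4) * z k ^ 2)) :=
    Integrable.fintype_prod (f := fun _ t => Real.exp (-(1/4) * t ^ 2))
      (fun _ => integrable_exp_neg_mul_sq (by norm_num))
  refine (h4.const_mul ((‖ℓ₁‖ + |c₁|) * (‖ℓ₂‖ + |c₂|) * 8)).mono'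
    (by fun_prop) (Filter.Eventually.of_forall fun z => ?_)
  rw [← Real.exp_sum, ← Finset.mul_sum]
  set s := ∑ k, z k ^ 2 with hs
  have hs0 : 0 ≤ s := Finset.sum_nonneg fun _ _ => sq_nonneg _
  have hz : ‖z‖ ≤ √s := by
    rw [pi_norm_le_iff_of_nonneg (Real.sqrt_nonneg _)]
    intro i
    apply Real.le_sqrt_of_sq_le
    rw [Real.norm_eq_abs, sq_abs]
    exact Finset.single_le_sum (f := fun k => z k ^ 2) (fun _ _ => sq_nonneg _) (Finset.mem_univ i)
  have hz2 : ‖z‖ ^ 2 ≤ s := by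
    calc ‖z‖ ^ 2 ≤ √s ^ 2 := by gcongr
      _ = s := Real.sq_sqrt hs0
  have hb : ∀ (ℓ : (Fin d → ℝ) →L[ℝ] ℝ) (c : ℝ), |ℓ z + c| ≤ (‖ℓ‖ + |c|) * (1 + ‖z‖) := by
    intro ℓ c
    have h1 := ℓ.le_opNorm z
    rw [Real.norm_eq_abs] at h1
    have h2 := abs_add_le (ℓ z) c
    have := norm_nonneg ℓ
    have := mul_nonneg (abs_nonneg c) (norm_nonneg z)
    nlinarith
  have he : Real.exp (-(1/2) * s) * (1 + ‖z‖) ^ 2 ≤ 8 * Real.exp (-(1/4) * s) := by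
    have e1 : Real.exp (-(1/4) * s) = Real.exp (-(1/2) * s) * Real.exp (s/4) := by
      rw [← Real.exp_add]; congr 1; ring
    have e2 := Real.add_one_le_exp (s/4)
    have e3 := Real.exp_pos (-(1/2) * s)
    rw [e1]
    have : (1 + ‖z‖) ^ 2 ≤ 8 * Real.exp (s/4) := by nlinarith [sq_nonneg (‖z‖ - 1)]
    nlinarith
  rw [norm_mul, norm_mul, Real.norm_eq_abs, Real.norm_eq_abs, Real.norm_eq_abs, Real.abs_exp]
  calc |ℓ₁ z + c₁| * |ℓ₂ z + c₂| * Real.exp (-(1/2) * s)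
      ≤ ((‖ℓ₁‖ + |c₁|) * (1 + ‖z‖)) * ((‖ℓ₂‖ + |c₂|) * (1 + ‖z‖)) * Real.exp (-(1/2) * s) := by
        gcongr
        · exact hb _ _
        · exact hb _ _
    _ = ((‖ℓ₁‖ + |c₁|) * (‖ℓ₂‖ + |c₂|)) * (Real.exp (-(1/2) * s) * (1 + ‖z‖) ^ 2) := by ring
    _ ≤ ((‖ℓ₁‖ + |c₁|) * (‖ℓ₂‖ + |c₂|)) * (8 * Real.exp (-(1/4) * s)) := by gcongr
    _ = _ := by ring

theorem gA_int {d : ℕ} (S : Matrix (Fin d) (Fin d) ℝ) (hS : S.det ≠ 0) (ν : Fin d → ℝ)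
    (ℓ₁ ℓ₂ : (Fin d → ℝ) →L[ℝ] ℝ) (c₁ c₂ : ℝ) :
    Integrable (fun x : Fin d → ℝ => (ℓ₁ (x - ν) + c₁) * (ℓ₂ (x - ν) + c₂) *
      Real.exp (-(1/2) * ∑ k, (S *ᵥ (x - ν)) k ^ 2)) := by
  let R := (Matrix.toLin' S⁻¹).toContinuousLinearMap
  have h := gA_std (ℓ₁.comp R) (ℓ₂.comp R) c₁ c₂
  have hm : Integrable (fun z : Fin d → ℝ => ((ℓ₁.comp R) z + c₁) * ((ℓ₂.comp R) z + c₂) *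
      Real.exp (-(1/2) * ∑ k, z k ^ 2)) (Measure.map (toLin' S) volume) := by
    rw [Real.map_matrix_volume_pi_eq_smul_volume_pi hS]
    exact h.smul_measure ENNReal.ofReal_ne_top
  have hc : Continuous (toLin' S) := (toLin' S).continuous_of_finiteDimensional
  have h2 := hm.comp_measurable hc.measurable
  have h3 := h2.comp_sub_right ν
  refine h3.congr (Filter.Eventually.of_forall fun x => ?_)
  have : S⁻¹ *ᵥ (S *ᵥ (x - ν)) = x - ν := by
    rw [mulVec_mulVec, nonsing_inv_mul _ (isUnit_iff_ne_zero.mpr hS), one_mulVec]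
  simp [R, this]

theorem gA_mass {d : ℕ} (S : Matrix (Fin d) (Fin d) ℝ) (hS : S.det ≠ 0) (ν : Fin d → ℝ) :
    ∫ x : Fin d → ℝ, Real.exp (-(1/2) * ∑ k, (S *ᵥ (x - ν)) k ^ 2) =
      |S.det|⁻¹ * √(2 * Real.pi) ^ d := by
  rw [integral_sub_right_eq_self (fun x => Real.exp (-(1/2) * ∑ k, (S *ᵥ x) k ^ 2)) ν]
  have hc : Continuous (toLin' S) := (toLin' S).continuous_of_finiteDimensional
  have h := integral_map (μ := volume) (φ := toLin' S) hc.measurable.aemeasurable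
    (f := fun z : Fin d → ℝ => Real.exp (-(1/2) * ∑ k, z k ^ 2))
    (Continuous.aestronglyMeasurable (by fun_prop))
  simp only [toLin'_apply] at h
  rw [← h, Real.map_matrix_volume_pi_eq_smul_volume_pi hS, integral_smul_measure,
    ENNReal.toReal_ofReal (abs_nonneg _), abs_inv, smul_eq_mul]
  congr 1
  simp_rw [Finset.mul_sum, Real.exp_sum]
  rw [integral_fintype_prod_volume_eq_pow (fun t : ℝ => Real.exp (-(1/2) * t ^ 2)),
    integral_gaussian, Fintype.card_fin]
  congr 2
  ring

theorem gA_main {d : ℕ} (S : Matrix (Fin d) (Fin d) ℝ) (hS : S.det ≠ 0) (ν : Fin d → ℝ)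
    (K : ℝ) (v : (Fin d → ℝ) → ℝ)
    (hv : v = fun x => K * Real.exp (-(1/2) * ∑ k, (S *ᵥ (x - ν)) k ^ 2))
    (B a : Matrix (Fin d) (Fin d) ℝ) (m : Fin d → ℝ) :
    ∫ x : Fin d → ℝ, (((B.mulVec x + m) ⬝ᵥ fun i => fderiv ℝ v x (Pi.single i 1)) +
        (1 / 2 : ℝ) * ∑ i, ∑ j, a i j *
          fderiv ℝ (fun y => fderiv ℝ v y (Pi.single j 1)) x (Pi.single i 1))
      = -B.trace * ∫ x, v x := by
  let T : Fin d → (Fin d → ℝ) →L[ℝ] ℝ := fun k =>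
    (ContinuousLinearMap.proj k).comp (Matrix.toLin' S).toContinuousLinearMap
  have hT : ∀ k x, (S *ᵥ x) k = T k x := fun k x => by simp [T]
  let U : (Fin d → ℝ) → (Fin d → ℝ) →L[ℝ] ℝ := fun w => ∑ k, (T k w) • T k
  have hint : ∀ (ℓ₁ ℓ₂ : (Fin d → ℝ) →L[ℝ] ℝ) (c₁ c₂ : ℝ),
      Integrable (fun x => (ℓ₁ (x - ν) + c₁) * (ℓ₂ (x - ν) + c₂) * v x) := by
    intro ℓ₁ ℓ₂ c₁ c₂
    refine ((gA_int S hS ν ℓ₁ ℓ₂ c₁ c₂).const_mul K).congr (Filter.Eventually.of_forall fun x => ?_)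
    simp only [hv]; ring
  have hd : ∀ x, HasFDerivAt v (-(v x) • ∑ k, (T k (x - ν)) • T k) x := by
    intro x
    have h1 : ∀ k, HasFDerivAt (fun x => T k (x - ν) ^ 2) ((2 * T k (x - ν)) • T k) x := by
      intro k
      have := ((T k).hasFDerivAt (x := x - ν)).comp x ((hasFDerivAt_id x).sub_const ν)
      simpa using this.pow 2
    have h2 := (((HasFDerivAt.fun_sum (u := Finset.univ) (fun k _ => h1 k)).const_mul
      (-(1/2))).exp).const_mul K
    have : v = fun x => K * Real.exp (-(1/2) * ∑ k, T k (x - ν) ^ 2) := by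
      rw [hv]; simp only [hT]
    rw [this]
    refine h2.congr_fderiv ?_
    ext w
    simp [Finset.mul_sum]
    refine Finset.sum_congr rfl fun k _ => ?_
    ring
  have hf : ∀ x w, fderiv ℝ v x w = -(U w (x - ν)) * v x := by
    intro x w
    rw [(hd x).fderiv]
    simp [U, Finset.mul_sum, Finset.sum_mul]
    refine Finset.sum_congr rfl fun k _ => ?_
    ring
  have hd2 : ∀ x w, HasFDerivAt (fun y => fderiv ℝ v y w)
      ((-(U w (x - ν))) • (-(v x) • ∑ k, (T k (x - ν)) • T k) + v x • (-(U w))) x := by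
    intro x w
    simp only [hf]
    have := ((U w).hasFDerivAt (x := x - ν)).comp x ((hasFDerivAt_id x).sub_const ν)
    exact this.neg.mul (hd x)
  have hf2 : ∀ x w u, fderiv ℝ (fun y => fderiv ℝ v y w) x u =
      (U w (x - ν) + 0) * (U u (x - ν) + 0) * v x + (-(U w u)) * v x := by
    intro x w u
    rw [(hd2 x w).fderiv, ← (hd x).fderiv]
    simp [hf]
    ring
  have hvi : Integrable v := by simpa using hint 0 0 1 1
  have hi1 : ∀ w, Integrable (fun x => fderiv ℝ v x w) := by
    intro w
    simpa [hf] using hint (-(U w)) 0 0 1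
  have hi2 : ∀ w u, Integrable (fun x => fderiv ℝ (fun y => fderiv ℝ v y w) x u) := by
    intro w u
    simp only [hf2]
    exact (hint _ _ _ _).add (hvi.const_mul _)
  have h0 : ∀ w u, ∫ x, fderiv ℝ (fun y => fderiv ℝ v y w) x u = 0 := by
    intro w u
    have := integral_mul_fderiv_eq_neg_fderiv_mul_of_integrable (μ := (volume : Measure (Fin d → ℝ)))
      (f := fun _ => (1 : ℝ)) (g := fun y => fderiv ℝ v y w) (v := u)
      (by simp) (by simpa using hi2 w u) (by simpa using hi1 w)
      (fun x _ => by fun_prop) (fun x _ => (hd2 x w).differentiableAt)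
    simpa using this
  let b : Fin d → (Fin d → ℝ) →L[ℝ] ℝ := fun k =>
    (ContinuousLinearMap.proj k).comp (Matrix.toLin' B).toContinuousLinearMap
  have hb : ∀ k x, (B *ᵥ x) k = b k x := fun k x => by simp [b]
  have hbd : ∀ i x, HasFDerivAt (fun x => b i x + m i) (b i) x := fun i x =>
    (b i).hasFDerivAt.add_const _
  have hi3 : ∀ i w, Integrable (fun x => (b i x + m i) * fderiv ℝ v x w) := by
    intro i w
    refine (hint (b i) (-(U w)) (b i ν + m i) 0).congr (Filter.Eventually.of_forall fun x => ?_)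
    simp [hf]; ring
  have h3 : ∀ i, ∫ x, (b i x + m i) * fderiv ℝ v x (Pi.single i 1) = - (B i i * ∫ x, v x) := by
    intro i
    have hbi : b i (Pi.single i 1) = B i i := by rw [← hb]; simp
    have := integral_mul_fderiv_eq_neg_fderiv_mul_of_integrable (μ := (volume : Measure (Fin d → ℝ)))
      (f := fun x => b i x + m i) (g := v) (v := Pi.single i 1)
      (by simpa only [(hbd _ _).fderiv] using hvi.const_mul _) (hi3 i _)
      (by
        refine (hint (b i) 0 (b i ν + m i) 1).congr (Filter.Eventually.of_forall fun x => ?_)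
        simp only [map_sub, ContinuousLinearMap.zero_apply]; ring)
      (fun x _ => (hbd i x).differentiableAt) (fun x _ => (hd x).differentiableAt)
    rw [this]
    simp only [(hbd _ _).fderiv, hbi, integral_const_mul]
  simp only [dotProduct, Pi.add_apply, hb]
  have I1 : Integrable (fun x => ∑ i, (b i x + m i) * fderiv ℝ v x (Pi.single i 1)) :=
    integrable_finsetSum _ fun i _ => hi3 i _
  have I2 : ∀ i, Integrable (fun x => ∑ j, a i j *
      fderiv ℝ (fun y => fderiv ℝ v y (Pi.single j 1)) x (Pi.single i 1)) := fun i =>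
    integrable_finsetSum _ fun j _ => (hi2 _ _).const_mul _
  have I3 : Integrable (fun x => (1 / 2 : ℝ) * ∑ i, ∑ j, a i j *
      fderiv ℝ (fun y => fderiv ℝ v y (Pi.single j 1)) x (Pi.single i 1)) :=
    (integrable_finsetSum _ fun i _ => I2 i).const_mul _
  have : ∀ i, ∫ x, ∑ j, a i j *
      fderiv ℝ (fun y => fderiv ℝ v y (Pi.single j 1)) x (Pi.single i 1) = 0 := by
    intro i
    rw [integral_finsetSum _ (fun j _ => (hi2 _ _).const_mul _)]
    simp [integral_const_mul, h0]
  rw [integral_add I1 I3, integral_const_mul, integral_finsetSum _ (fun i _ => hi3 i _),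
    integral_finsetSum _ (fun i _ => I2 i)]
  simp [this, h3, Matrix.trace, Finset.sum_mul]

open scoped MatrixOrder Matrix.Norms.L2Operator in
theorem gA_factor {d : ℕ} (Q : Matrix (Fin d) (Fin d) ℝ) (hQ : Q.PosDef) :
    ∃ S : Matrix (Fin d) (Fin d) ℝ, Q = Sᵀ * S := by
  obtain ⟨y, hy⟩ := CStarAlgebra.nonneg_iff_eq_star_mul_self.mp hQ.posSemidef.nonneg
  exact ⟨y, by rw [hy, star_eq_conjTranspose, conjTranspose_eq_transpose_of_trivial]⟩

/-- Integral of the generator of the linear diffusion `dX = (BX + m)dt + σ dW` applied to the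
scaled Gaussian density `v`: `∫ 𝔏v(x) dx = −Tr(B) · C`, where
`𝔏v(x) = ⟨Bx + m, ∇v(x)⟩ + ½ Σᵢⱼ aᵢⱼ ∂²v/∂xᵢ∂xⱼ(x)` and `a = σσᵀ`. -/
theorem integral_generator_gaussian_density
    {d d' : ℕ} (hd : 1 ≤ d) (hd' : 1 ≤ d')
    (P : Matrix (Fin d) (Fin d) ℝ) (hP : P.PosDef)
    (ν : Fin d → ℝ) (C : ℝ) (hC : 0 < C)
    (B : Matrix (Fin d) (Fin d) ℝ) (m : Fin d → ℝ)
    (σ : Matrix (Fin d) (Fin d') ℝ) (a : Matrix (Fin d) (Fin d) ℝ) (ha : a = σ * σᵀ)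
    (v : (Fin d → ℝ) → ℝ)
    (hv : v = fun x => C * (2 * Real.pi) ^ (-(d : ℝ) / 2) * P.det ^ (-(1 : ℝ) / 2) *
      Real.exp (-(1 / 2 : ℝ) * ((x - ν) ⬝ᵥ P⁻¹.mulVec (x - ν))))
    (L : ((Fin d → ℝ) → ℝ) → (Fin d → ℝ) → ℝ)
    (hL : L = fun f x =>
      ((B.mulVec x + m) ⬝ᵥ fun i => fderiv ℝ f x (Pi.single i 1)) +
        (1 / 2 : ℝ) * ∑ i, ∑ j, a i j *
          fderiv ℝ (fun y => fderiv ℝ f y (Pi.single j 1)) x (Pi.single i 1)) :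
    ∫ x : Fin d → ℝ, L v x = -B.trace * C := by
  obtain ⟨S, hS⟩ := gA_factor P⁻¹ hP.inv
  have hP0 : 0 < P.det := hP.det_pos
  have hdet : P.det⁻¹ = S.det ^ 2 := by
    have := congrArg Matrix.det hS
    rw [det_mul, det_transpose, det_nonsing_inv, Ring.inverse_eq_inv'] at this
    rw [this, sq]
  have hS0 : S.det ≠ 0 := by
    intro h
    rw [h] at hdet
    have := inv_pos.mpr hP0
    simp [hdet] at this
  have hv' : v = fun x => (C * (2 * Real.pi) ^ (-(d : ℝ) / 2) * P.det ^ (-(1 : ℝ) / 2)) *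
      Real.exp (-(1/2) * ∑ k, (S *ᵥ (x - ν)) k ^ 2) := by
    rw [hv]
    funext x
    rw [hS, ← mulVec_mulVec, dotProduct_mulVec, vecMul_transpose]
    simp only [dotProduct, sq]
  rw [hL]
  refine (gA_main S hS0 ν _ v hv' B a m).trans ?_
  congr 1
  simp only [hv', integral_const_mul]
  rw [gA_mass S hS0 ν]
  have e1 : |S.det|⁻¹ = P.det ^ ((1 : ℝ) / 2) := by
    rw [← Real.sqrt_sq_eq_abs, ← hdet, Real.sqrt_inv, inv_inv, Real.sqrt_eq_rpow]
  have e2 : √(2 * Real.pi) ^ d = (2 * Real.pi) ^ ((d : ℝ) / 2) := by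
    rw [Real.sqrt_eq_rpow, ← Real.rpow_natCast, ← Real.rpow_mul (by positivity)]
    congr 1; ring
  rw [e1, e2]
  have e3 : P.det ^ (-(1 : ℝ) / 2) * P.det ^ ((1 : ℝ) / 2) = 1 := by
    rw [← Real.rpow_add hP0]; norm_num
  have e4 : (2 * Real.pi) ^ (-(d : ℝ) / 2) * (2 * Real.pi) ^ ((d : ℝ) / 2) = 1 := by
    rw [← Real.rpow_add (by positivity), neg_div, neg_add_cancel, Real.rpow_zero]
  linear_combination C * (2 * Real.pi) ^ (-(d : ℝ) / 2) * (2 * Real.pi) ^ ((d : ℝ) / 2) * e3 + C * e4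
end
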